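/- arXiv:1807.03295 — 2 statements merged into one kernel-verified Lean document; each statement's English description precedes it below -/
import Mathlib

section
/- Let B be an m × 3 complex matrix and suppose that the space of homogeneous degree-2 polynomials in 3 variables over ℂ vanishing at every row of B is one-dimensional and is spanned by a product ℓ₁ · ℓ₂ of two linearly independent linear forms (i.e., the point configuration lies on a unique conic and that conic is reducible). Then there exists an injective ℂ-linear map C : (Fin 5 → ℂ) → (Fin m → ℂ) such that (fun x i => (x i)^2) '' {B.mulVec v | v : Fin 3 → ℂ} = C '' {y : Fin 5 → ℂ | (y 3)^2 = y 0 * y 1 ∧ (y 4)^2 = y 0 * y 2}. (The coordinate-wise square of such a plane is, up to linear re-embedding, the intersection of the two quadrics y₃² = y₀y₁ and y₄² = y₀y₂ in ℙ⁴.) -/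
open MvPolynomial

/-- A form of degree one is a linear combination of the variables. -/
lemma MvPolynomial.IsHomogeneous.exists_linearCombination_X {σ R : Type*} [Fintype σ]
    [CommSemiring R] {l : MvPolynomial σ R} (hl : l.IsHomogeneous 1) :
    ∃ a : σ → R, l = Fintype.linearCombination R X a := by
  rw [← mem_homogeneousSubmodule, homogeneousSubmodule_one_eq_span_X,
    Submodule.mem_span_range_iff_exists_fun] at hl
  obtain ⟨a, ha⟩ := hl
  exact ⟨a, by rw [Fintype.linearCombination_apply, ha]⟩

lemma MvPolynomial.isHomogeneous_linearCombination_X {σ R : Type*} [Fintype σ]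
    [CommSemiring R] (a : σ → R) :
    (Fintype.linearCombination R (X : σ → MvPolynomial σ R) a).IsHomogeneous 1 := by
  rw [← mem_homogeneousSubmodule, homogeneousSubmodule_one_eq_span_X,
    Submodule.mem_span_range_iff_exists_fun]
  exact ⟨a, by rw [Fintype.linearCombination_apply]⟩

lemma MvPolynomial.eval_linearCombination_X {σ R : Type*} [Fintype σ]
    [CommSemiring R] (a x : σ → R) :
    eval x (Fintype.linearCombination R (X : σ → MvPolynomial σ R) a) = a ⬝ᵥ x := by
  simp [Fintype.linearCombination_apply, dotProduct, smul_eval]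

/-- Two linearly independent vectors in a three-dimensional space are the last two rows of an
invertible matrix. -/
lemma exists_isUnit_det_of_linearIndependent {K : Type*} [Field K] {a b : Fin 3 → K}
    (h : LinearIndependent K ![a, b]) :
    ∃ e : Fin 3 → K, IsUnit (Matrix.det (Matrix.of ![e, a, b])) := by
  rw [← crossProduct_ne_zero_iff_linearIndependent] at h
  obtain ⟨i, hi⟩ := Function.ne_iff.mp h
  refine ⟨Pi.single i 1, isUnit_iff_ne_zero.mpr ?_⟩
  have := triple_product_eq_det (Pi.single i 1) a b
  rw [single_one_dotProduct] at this
  exact this ▸ hi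

/-- The linear map with rows `(u₀², u₁², u₂², 2u₀u₁, 2u₀u₂)`, where `u` runs over the rows
of `U`. -/
def squareMap {K : Type*} [Field K] {m : ℕ} (U : Matrix (Fin m) (Fin 3) K) :
    (Fin 5 → K) →ₗ[K] (Fin m → K) :=
  Matrix.mulVecLin (Matrix.of fun i =>
    ![U i 0 ^ 2, U i 1 ^ 2, U i 2 ^ 2, 2 * U i 0 * U i 1, 2 * U i 0 * U i 2])

lemma squareMap_apply {K : Type*} [Field K] {m : ℕ} (U : Matrix (Fin m) (Fin 3) K)
    (y : Fin 5 → K) (i : Fin m) :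
    squareMap U y i = U i 0 ^ 2 * y 0 + U i 1 ^ 2 * y 1 + U i 2 ^ 2 * y 2
      + 2 * U i 0 * U i 1 * y 3 + 2 * U i 0 * U i 2 * y 4 := by
  simp [squareMap, Matrix.mulVec, dotProduct, Fin.sum_univ_five]

lemma sq_mulVec_eq_squareMap {K : Type*} [Field K] {m : ℕ} {U : Matrix (Fin m) (Fin 3) K}
    (hU : ∀ i, U i 1 * U i 2 = 0) (w : Fin 3 → K) :
    (fun i => U.mulVec w i ^ 2)
      = squareMap U ![w 0 ^ 2, w 1 ^ 2, w 2 ^ 2, w 0 * w 1, w 0 * w 2] := by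
  ext i
  rw [squareMap_apply]
  simp [Matrix.mulVec, dotProduct, Fin.sum_univ_three]
  linear_combination (2 * w 1 * w 2) * hU i

lemma exists_eq_products_of_sq_eq {K : Type*} [Field K] [IsAlgClosed K] {y : Fin 5 → K}
    (h₃ : y 3 ^ 2 = y 0 * y 1) (h₄ : y 4 ^ 2 = y 0 * y 2) :
    ∃ w : Fin 3 → K, y = ![w 0 ^ 2, w 1 ^ 2, w 2 ^ 2, w 0 * w 1, w 0 * w 2] := by
  by_cases h : y 0 = 0
  · obtain ⟨r, hr⟩ := IsAlgClosed.exists_pow_nat_eq (y 1) (n := 2) (by norm_num)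
    obtain ⟨s, hs⟩ := IsAlgClosed.exists_pow_nat_eq (y 2) (n := 2) (by norm_num)
    refine ⟨![0, r, s], ?_⟩
    have h₃' : y 3 = 0 := by simpa [h] using h₃
    have h₄' : y 4 = 0 := by simpa [h] using h₄
    ext i
    fin_cases i <;> simp [h, h₃', h₄', hr, hs]
  · obtain ⟨r, hr⟩ := IsAlgClosed.exists_pow_nat_eq (y 0) (n := 2) (by norm_num)
    have hr₀ : r ≠ 0 := by
      rintro rfl
      exact h (by simpa using hr.symm)
    refine ⟨![r, y 3 / r, y 4 / r], ?_⟩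
    ext i
    fin_cases i <;> simp [hr, div_pow, h₃, h₄, h, mul_div_cancel₀, hr₀]

lemma squareMap_injective {m : ℕ} {B : Matrix (Fin m) (Fin 3) ℂ} {P : Matrix (Fin 3) (Fin 3) ℂ}
    (hP : IsUnit P.det)
    (h : ∀ p : MvPolynomial (Fin 3) ℂ, p.IsHomogeneous 2 →
      (∀ i, eval (fun j => B i j) p = 0) → ∃ c : ℂ, p = c •
        (Fintype.linearCombination ℂ X (P 1) * Fintype.linearCombination ℂ X (P 2))) :
    Function.Injective (squareMap (B * P.transpose)) := by
  rw [injective_iff_map_eq_zero]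
  intro y hy
  let L : Fin 3 → MvPolynomial (Fin 3) ℂ := fun k => Fintype.linearCombination ℂ X (P k)
  have hL (j k : Fin 3) (c : ℂ) : (C c * (L j * L k)).IsHomogeneous 2 := by
    simpa using (isHomogeneous_C (Fin 3) c).mul
      ((isHomogeneous_linearCombination_X (P j)).mul (isHomogeneous_linearCombination_X (P k)))
  have heval (k : Fin 3) (x : Fin 3 → ℂ) : eval x (L k) = P.mulVec x k :=
    eval_linearCombination_X _ _
  obtain ⟨c, hc⟩ := h
    (C (y 0) * (L 0 * L 0) + C (y 1) * (L 1 * L 1) + C (y 2) * (L 2 * L 2)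
      + C (2 * y 3) * (L 0 * L 1) + C (2 * y 4) * (L 0 * L 2))
    (((((hL _ _ _).add (hL _ _ _)).add (hL _ _ _)).add (hL _ _ _)).add (hL _ _ _)) (by
      intro i
      have hi := congrFun hy i
      rw [squareMap_apply] at hi
      have hk (k : Fin 3) : P.mulVec (fun j => B i j) k = (B * P.transpose) i k := by
        simp [Matrix.mulVec, Matrix.mul_apply, dotProduct, mul_comm]
      simp only [map_add, map_mul, eval_C, heval, hk]
      simp only [Pi.zero_apply] at hi
      linear_combination hi)
  have key (z : Fin 3 → ℂ) : y 0 * (z 0 * z 0) + y 1 * (z 1 * z 1) + y 2 * (z 2 * z 2)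
      + 2 * y 3 * (z 0 * z 1) + 2 * y 4 * (z 0 * z 2) = c * (z 1 * z 2) := by
    have hz : P.mulVec (P⁻¹.mulVec z) = z := by
      rw [Matrix.mulVec_mulVec, Matrix.mul_nonsing_inv _ hP, Matrix.one_mulVec]
    have := congrArg (eval (P⁻¹.mulVec z)) hc
    change _ = eval _ (c • (L 1 * L 2)) at this
    simpa only [map_add, map_mul, eval_C, smul_eval, heval, hz] using this
  have h₀ : y 0 = 0 := by simpa using key ![1, 0, 0]
  have h₁ : y 1 = 0 := by simpa using key ![0, 1, 0]
  have h₂ : y 2 = 0 := by simpa using key ![0, 0, 1]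
  have h₃ : y 3 = 0 := by simpa [h₀, h₁] using key ![1, 1, 0]
  have h₄ : y 4 = 0 := by simpa [h₀, h₂] using key ![1, 0, 1]
  ext i
  fin_cases i <;> assumption

/-- If the point configuration of a plane lies on a unique conic and that conic is
reducible (the degree-2 forms vanishing on the rows of `B` are exactly the scalar
multiples of a product `ℓ₁·ℓ₂` of two linearly independent linear forms), then the
coordinate-wise square of the plane is a linear re-embedding of the complete
intersection `{y₃² = y₀y₁, y₄² = y₀y₂}` in `ℙ⁴`. -/
theorem square_of_plane_reducible_conic (m : ℕ) (B : Matrix (Fin m) (Fin 3) ℂ)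
    (l₁ l₂ : MvPolynomial (Fin 3) ℂ)
    (hl₁ : l₁.IsHomogeneous 1) (hl₂ : l₂.IsHomogeneous 1)
    (hli : LinearIndependent ℂ ![l₁, l₂])
    (hconic : ∀ p : MvPolynomial (Fin 3) ℂ,
      (p.IsHomogeneous 2 ∧ ∀ i, eval (fun j => B i j) p = 0)
        ↔ ∃ c : ℂ, p = c • (l₁ * l₂)) :
    ∃ C : (Fin 5 → ℂ) →ₗ[ℂ] (Fin m → ℂ), Function.Injective C ∧
      (fun x : Fin m → ℂ => fun i => (x i) ^ 2) ''
          {y : Fin m → ℂ | ∃ v : Fin 3 → ℂ, y = B.mulVec v}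
        = C '' {y : Fin 5 → ℂ | (y 3) ^ 2 = y 0 * y 1 ∧ (y 4) ^ 2 = y 0 * y 2} := by
  obtain ⟨a, rfl⟩ := hl₁.exists_linearCombination_X
  obtain ⟨b, rfl⟩ := hl₂.exists_linearCombination_X
  have hab : LinearIndependent ℂ ![a, b] := by
    refine LinearIndependent.of_comp
      (Fintype.linearCombination ℂ (X : Fin 3 → MvPolynomial (Fin 3) ℂ)) ?_
    convert hli using 1
    ext k : 1
    fin_cases k <;> rfl
  obtain ⟨e, hP⟩ := exists_isUnit_det_of_linearIndependent hab
  set P : Matrix (Fin 3) (Fin 3) ℂ := Matrix.of ![e, a, b]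
  have hU (i : Fin m) : (B * P.transpose) i 1 * (B * P.transpose) i 2 = 0 := by
    have h := ((hconic _).mpr ⟨1, (one_smul ℂ _).symm⟩).2 i
    rw [map_mul, eval_linearCombination_X, eval_linearCombination_X,
      dotProduct_comm, dotProduct_comm b] at h
    exact h
  refine ⟨squareMap (B * P.transpose),
    squareMap_injective hP fun p hp hpB => (hconic p).mp ⟨hp, hpB⟩, ?_⟩
  ext x
  constructor
  · rintro ⟨_, ⟨v, rfl⟩, rfl⟩
    have hv : B.mulVec v = (B * P.transpose).mulVec (P.transpose⁻¹.mulVec v) := by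
      rw [Matrix.mulVec_mulVec, Matrix.mul_assoc,
        Matrix.mul_nonsing_inv _ (by rwa [Matrix.det_transpose]), Matrix.mul_one]
    refine ⟨_, ?_, (sq_mulVec_eq_squareMap hU (P.transpose⁻¹.mulVec v)).symm.trans ?_⟩
    · constructor <;> simp <;> ring
    · rw [← hv]
  · rintro ⟨y, ⟨h₃, h₄⟩, rfl⟩
    obtain ⟨w, rfl⟩ := exists_eq_products_of_sq_eq h₃ h₄
    refine ⟨_, ⟨P.transpose.mulVec w, rfl⟩, ?_⟩
    rw [Matrix.mulVec_mulVec]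
    exact sq_mulVec_eq_squareMap hU w
end

section
/- Let N and s be natural numbers with 2 ≤ s ≤ N, let Y be a symmetric N × N complex matrix, and let I_s denote the diagonal N × N matrix whose (i,i) entry is 1 if i < s and 0 otherwise. Write D(a,b) := Y a a * Y b b − (Y a b)^2, and for indices write Y_{ab|cd} := Y a c * Y b d − Y a d * Y b c. Then the following are equivalent: (1) there exists t ∈ ℂ such that the matrix Y + t • I_s has rank at most 1; (2) all of the following hold: (E) Y_{ab|cd} = 0 whenever a ≠ b, c ≠ d, and every index belonging to both {a,b} and {c,d} is ≥ s; (F) Y_{ic|id} = Y_{jc|jd} whenever i < s, j < s, c ∉ {i,j}, d ∉ {i,j}, and (c ≠ d or c ≥ s); (G) D(i,j) − D(j,k) + D(k,l) − D(l,i) = 0 for all pairwise distinct i, j, k, l < s; (H1) Y i l * (D(i,j) − D(i,l)) − (Y l l − Y j j) * (Y i j * Y j l − Y i l * Y j j) = 0 for all pairwise distinct i, j, l < s; (H2) (Y i i − Y j j) * D(i,j) + (Y j j − Y l l) * D(j,l) + (Y l l − Y i i) * D(l,i) = 0 for all pairwise distinct i, j, l < s. -/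
open Matrix

/-- The 2×2 minor of a square complex matrix `Y` with rows `a, b` and columns `c, d`. -/
def minor2C {N : ℕ} (Y : Matrix (Fin N) (Fin N) ℂ) (a b c d : Fin N) : ℂ :=
  Y a c * Y b d - Y a d * Y b c

/-- The principal 2×2 minor `D(a,b) = Y a a * Y b b − (Y a b)²` of a symmetric matrix. -/
def princMinor {N : ℕ} (Y : Matrix (Fin N) (Fin N) ℂ) (a b : Fin N) : ℂ :=
  Y a a * Y b b - (Y a b) ^ 2

theorem rank_le_one_of_pivot {m n K : Type*} [Fintype n] [Field K] (A : Matrix m n K)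
    (c : m) (d : n) (hcd : A c d ≠ 0) (h : ∀ a b, A a b * A c d = A a d * A c b) :
    A.rank ≤ 1 := by
  have hA : A = vecMulVec (fun a => A a d / A c d) (fun b => A c b) := by
    ext a b
    rw [vecMulVec_apply, div_mul_eq_mul_div, eq_div_iff hcd, h]
  rw [hA]
  exact rank_vecMulVec_le _ _

theorem mul_eq_mul_of_rank_le_one {m n K : Type*} [Fintype n] [Field K] (A : Matrix m n K)
    (h : A.rank ≤ 1) (a b : m) (c d : n) : A a c * A b d = A a d * A b c := by
  by_contra hne
  have hdet : (A.submatrix ![a, b] ![c, d]).det ≠ 0 := by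
    rw [det_fin_two]
    simpa [sub_eq_zero] using hne
  have hle := rank_submatrix_le A ![a, b] ![c, d]
  rw [rank_of_det_ne_zero hdet, Fintype.card_fin] at hle
  omega

/-- The diagonal matrix `I_s`: ones in the first `s` diagonal places, zeros elsewhere. -/
abbrev partialId (N s : ℕ) : Matrix (Fin N) (Fin N) ℂ :=
  Matrix.diagonal (fun i : Fin N => if (i : ℕ) < s then (1 : ℂ) else 0)

theorem add_smul_partialId_apply_self {N s : ℕ} (Y : Matrix (Fin N) (Fin N) ℂ) (t : ℂ)
    {i : Fin N} (hi : (i : ℕ) < s) : (Y + t • partialId N s) i i = Y i i + t := by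
  simp [hi]

theorem add_smul_partialId_apply_of_ne {N s : ℕ} (Y : Matrix (Fin N) (Fin N) ℂ) (t : ℂ)
    {i j : Fin N} (h : i ≠ j ∨ s ≤ (i : ℕ)) : (Y + t • partialId N s) i j = Y i j := by
  by_cases hij : i = j
  · subst hij
    have : ¬ (i : ℕ) < s := by simpa using h
    simp [this]
  · simp [hij]

/-- The cubic relations on a symmetric `3 × 3` matrix with diagonal `x, y, z` and off-diagonal
entries `p, q, r` force the principal minor and the mixed minors at the pivot `p` to vanish. -/
theorem minors_eq_of_cubic_relations {K : Type*} [Field K] {x y z p q r : K} (hp : p ≠ 0)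
    (hz : z * p = q * r)
    (h₁ : p * ((x * z - q ^ 2) - (x * y - p ^ 2)) = (y - z) * (q * r - p * z))
    (h₂ : p * ((y * z - r ^ 2) - (x * y - p ^ 2)) = (x - z) * (q * r - p * z))
    (h₃ : q * ((x * y - p ^ 2) - (x * z - q ^ 2)) = (z - y) * (p * r - q * y))
    (h₄ : r * ((x * y - p ^ 2) - (y * z - r ^ 2)) = (z - x) * (p * q - r * x)) :
    x * y = p ^ 2 ∧ y * q = p * r ∧ x * r = p * q := by
  have e₁ : x * z - q ^ 2 = x * y - p ^ 2 := by
    apply mul_left_cancel₀ hp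
    linear_combination h₁ - (y - z) * hz
  have e₂ : y * z - r ^ 2 = x * y - p ^ 2 := by
    apply mul_left_cancel₀ hp
    linear_combination h₂ - (x - z) * hz
  have f₃ : (z - y) * (p * r - q * y) = 0 := by linear_combination -h₃ - q * e₁
  have f₄ : (z - x) * (p * q - r * x) = 0 := by linear_combination -h₄ - r * e₂
  by_cases hz0 : z = 0
  · have hqr : q * r = 0 := by rw [← hz, hz0, zero_mul]
    have hq2 : q ^ 2 = r ^ 2 := by linear_combination e₂ - e₁ + (x - y) * hz0
    have hq : q = 0 := by
      rcases mul_eq_zero.1 hqr with h | h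
      · exact h
      · simpa [h] using hq2
    have hr : r = 0 := by simpa [hq] using hq2.symm
    subst hq hr hz0
    refine ⟨by linear_combination -e₁, by ring, by ring⟩
  have hqr : q * r ≠ 0 := hz ▸ mul_ne_zero hz0 hp
  rcases mul_eq_zero.1 f₃ with h | h
  · have hzy : y = z := by linear_combination -h
    subst hzy
    have hpq : p ^ 2 = q ^ 2 := by linear_combination e₁
    have hyr : y ^ 2 = r ^ 2 := by
      apply mul_right_cancel₀ (pow_ne_zero 2 hp)
      linear_combination (y * p + q * r) * hz - r ^ 2 * hpq
    have hxy : x * y = p ^ 2 := by linear_combination hyr - e₂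
    refine ⟨hxy, ?_, ?_⟩
    · apply mul_right_cancel₀ hp
      linear_combination q * hz - r * hpq
    · apply mul_right_cancel₀ (mul_ne_zero hz0 hp)
      linear_combination r * p * hxy - p * q * hz + p * r * hpq
  rcases mul_eq_zero.1 f₄ with h' | h'
  · have hzx : x = z := by linear_combination -h'
    subst hzx
    have hpr : p ^ 2 = r ^ 2 := by linear_combination e₂
    have hxq : x ^ 2 = q ^ 2 := by
      apply mul_right_cancel₀ (pow_ne_zero 2 hp)
      linear_combination (x * p + q * r) * hz - q ^ 2 * hpr
    have hxy : x * y = p ^ 2 := by linear_combination hxq - e₁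
    refine ⟨hxy, by linear_combination -h, ?_⟩
    apply mul_right_cancel₀ hp
    linear_combination r * hz - q * hpr
  · refine ⟨?_, by linear_combination -h, by linear_combination -h'⟩
    apply mul_right_cancel₀ hqr
    linear_combination -x * r * h - p * r * h'

section Completion

variable {N s : ℕ} {Y : Matrix (Fin N) (Fin N) ℂ}

theorem relations_of_rank_le_one (hY : Y.IsSymm) {t : ℂ}
    (ht : (Y + t • partialId N s).rank ≤ 1) :
    (∀ a b c d : Fin N, a ≠ b → c ≠ d →
        (∀ x : Fin N, (x = a ∨ x = b) → (x = c ∨ x = d) → s ≤ (x : ℕ)) →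
        minor2C Y a b c d = 0) ∧
    (∀ i c d : Fin N, (i : ℕ) < s → c ≠ i → d ≠ i → (c ≠ d ∨ s ≤ (c : ℕ)) →
        minor2C Y i c i d = -t * Y c d) ∧
    (∀ i j : Fin N, (i : ℕ) < s → (j : ℕ) < s → i ≠ j →
        princMinor Y i j = -t * (Y i i + Y j j) - t ^ 2) ∧
    (∀ i j l : Fin N, (j : ℕ) < s → i ≠ j → i ≠ l → j ≠ l →
        Y i j * Y j l - Y i l * Y j j = t * Y i l) := by
  have hm := mul_eq_mul_of_rank_le_one _ ht
  have hd := fun {i : Fin N} => add_smul_partialId_apply_self (s := s) Y t (i := i)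
  have ho := fun {i j : Fin N} => add_smul_partialId_apply_of_ne (s := s) Y t (i := i) (j := j)
  refine ⟨fun a b c d hab hcd hx => ?_, fun i c d hi hc hd' hcd => ?_, fun i j hi hj hij => ?_,
    fun i j l hj hij hil hjl => ?_⟩
  · have key : ∀ u v : Fin N, (u = a ∨ u = b) → (v = c ∨ v = d) → u ≠ v ∨ s ≤ (u : ℕ) := by
      intro u v hu hv
      by_cases huv : u = v
      · exact Or.inr (hx u hu (huv ▸ hv))
      · exact Or.inl huv
    have h := hm a b c d
    rw [ho (key a c (by simp) (by simp)), ho (key b d (by simp) (by simp)),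
      ho (key a d (by simp) (by simp)), ho (key b c (by simp) (by simp))] at h
    rw [minor2C, h, sub_self]
  · have h := hm i c i d
    rw [hd hi, ho hcd, ho (.inl hd'.symm), ho (.inl hc)] at h
    rw [minor2C]
    linear_combination h
  · have h := hm i j i j
    rw [hd hi, hd hj, ho (.inl hij), ho (.inl hij.symm), hY.apply i j] at h
    rw [princMinor]
    linear_combination h
  · have h := hm i j j l
    rw [hd hj, ho (.inl hij), ho (.inl hil), ho (.inl hjl)] at h
    linear_combination h

theorem exists_rank_le_one_of_pivot_ge (hs : 0 < s)
    (hE : ∀ a b c d : Fin N, a ≠ b → c ≠ d →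
        (∀ x : Fin N, (x = a ∨ x = b) → (x = c ∨ x = d) → s ≤ (x : ℕ)) →
        minor2C Y a b c d = 0)
    (hF : ∀ i j c d : Fin N, (i : ℕ) < s → (j : ℕ) < s →
        c ≠ i → c ≠ j → d ≠ i → d ≠ j → (c ≠ d ∨ s ≤ (c : ℕ)) →
        minor2C Y i c i d = minor2C Y j c j d)
    {c d : Fin N} (hc : s ≤ (c : ℕ)) (hd : s ≤ (d : ℕ)) (hcd : Y c d ≠ 0) :
    ∃ t : ℂ, (Y + t • partialId N s).rank ≤ 1 := by
  have hne : ∀ {i k : Fin N}, (i : ℕ) < s → s ≤ (k : ℕ) → k ≠ i := by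
    rintro i k hi hk rfl
    omega
  let o : Fin N := ⟨0, by omega⟩
  have ho : (o : ℕ) < s := hs
  refine ⟨-minor2C Y o c o d / Y c d, rank_le_one_of_pivot _ c d ?_ fun a b => ?_⟩
  · rwa [add_smul_partialId_apply_of_ne Y _ (.inr hc)]
  have had : a ≠ d ∨ s ≤ (a : ℕ) := by
    by_cases h : a = d
    · exact .inr (h ▸ hd)
    · exact .inl h
  rw [add_smul_partialId_apply_of_ne Y _ (.inr hc), add_smul_partialId_apply_of_ne Y _ (.inr hc),
    add_smul_partialId_apply_of_ne Y _ had]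
  by_cases hab : a ≠ b ∨ s ≤ (a : ℕ)
  · rw [add_smul_partialId_apply_of_ne Y _ hab]
    by_cases hac : a = c
    · rw [hac, mul_comm]
    by_cases hbd : b = d
    · rw [hbd]
    have h := hE a c b d hac hbd (by
      rintro x (rfl | rfl) (rfl | rfl)
      · simpa using hab
      all_goals assumption)
    rw [minor2C] at h
    linear_combination h
  · push Not at hab
    obtain ⟨rfl, ha⟩ := hab
    rw [add_smul_partialId_apply_self Y _ ha]
    have h := hF a o c d ha ho (hne ha hc) (hne ho hc) (hne ha hd) (hne ho hd) (.inr hc)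
    rw [← h, minor2C]
    field_simp
    ring

theorem eq_zero_of_block_eq_zero (hs : 2 ≤ s) (hsN : s ≤ N)
    (hE : ∀ a b c d : Fin N, a ≠ b → c ≠ d →
        (∀ x : Fin N, (x = a ∨ x = b) → (x = c ∨ x = d) → s ≤ (x : ℕ)) →
        minor2C Y a b c d = 0)
    (hF : ∀ i j c d : Fin N, (i : ℕ) < s → (j : ℕ) < s →
        c ≠ i → c ≠ j → d ≠ i → d ≠ j → (c ≠ d ∨ s ≤ (c : ℕ)) →
        minor2C Y i c i d = minor2C Y j c j d)
    (hY : Y.IsSymm) (h0 : ∀ c d : Fin N, s ≤ (c : ℕ) → s ≤ (d : ℕ) → Y c d = 0)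
    (c d : Fin N) (hd : s ≤ (d : ℕ)) : Y c d = 0 := by
  by_cases hc : s ≤ (c : ℕ)
  · exact h0 c d hc hd
  push Not at hc
  obtain ⟨j, hj, hjc⟩ : ∃ j : Fin N, (j : ℕ) < s ∧ j ≠ c := by
    by_cases h : (c : ℕ) = 0
    · exact ⟨⟨1, by omega⟩, by simp; omega, by simp [Fin.ext_iff]; omega⟩
    · exact ⟨⟨0, by omega⟩, by simp; omega, by simp [Fin.ext_iff]; omega⟩
  have hne : ∀ {i : Fin N}, (i : ℕ) < s → d ≠ i := by
    rintro i hi rfl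
    omega
  have h₁ := hE c d j d (hne hc).symm (hne hj).symm (by
    rintro x (rfl | rfl) (rfl | h)
    · exact absurd rfl hjc
    · exact absurd h.symm (hne hc)
    all_goals exact hd)
  have h₂ := hF c j d d hc hj (hne hc) (hne hj) (hne hc) (hne hj) (.inr hd)
  simp only [minor2C, h0 d d hd hd, mul_zero, zero_sub, neg_eq_zero, neg_inj] at h₁ h₂
  rw [hY.apply c d, hY.apply j d] at h₂
  rw [hY.apply j d] at h₁
  rcases mul_eq_zero.1 h₁ with h | h
  · exact h
  · simpa [h] using h₂

theorem exists_rank_le_one_of_pivot_lt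
    (hE : ∀ a b c d : Fin N, a ≠ b → c ≠ d →
        (∀ x : Fin N, (x = a ∨ x = b) → (x = c ∨ x = d) → s ≤ (x : ℕ)) →
        minor2C Y a b c d = 0)
    (hF : ∀ i j c d : Fin N, (i : ℕ) < s → (j : ℕ) < s →
        c ≠ i → c ≠ j → d ≠ i → d ≠ j → (c ≠ d ∨ s ≤ (c : ℕ)) →
        minor2C Y i c i d = minor2C Y j c j d)
    (hH : ∀ i j l : Fin N, (i : ℕ) < s → (j : ℕ) < s → (l : ℕ) < s →
        i ≠ j → i ≠ l → j ≠ l →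
        Y i l * (princMinor Y i j - princMinor Y i l)
          - (Y l l - Y j j) * (Y i j * Y j l - Y i l * Y j j) = 0)
    (hY : Y.IsSymm) (h0 : ∀ c d : Fin N, s ≤ (d : ℕ) → Y c d = 0)
    {c d : Fin N} (hc : (c : ℕ) < s) (hd : (d : ℕ) < s) (hne : c ≠ d) (hcd : Y c d ≠ 0) :
    ∃ t : ℂ, (Y + t • partialId N s).rank ≤ 1 := by
  have h0' : ∀ c d : Fin N, s ≤ (c : ℕ) → Y c d = 0 := fun c d h => by
    rw [← hY.apply c d, h0 d c h]
  have cubic : ∀ (t : ℂ) (j : Fin N), (j : ℕ) < s → j ≠ c → j ≠ d →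
      (Y j j + t) * Y c d = Y c j * Y d j →
      (Y c c + t) * (Y d d + t) = Y c d ^ 2 ∧ (Y d d + t) * Y c j = Y c d * Y d j ∧
        (Y c c + t) * Y d j = Y c d * Y c j := by
    intro t j hj hjc hjd hz
    have h₁ := hH c j d hc hj hd hjc.symm hne hjd
    have h₂ := hH d j c hd hj hc hjd.symm hne.symm hjc
    have h₃ := hH c d j hc hd hj hne hjc.symm hjd.symm
    have h₄ := hH d c j hd hc hj hne.symm hjd.symm hjc.symm
    simp only [princMinor, hY.apply c d, hY.apply c j, hY.apply d j] at h₁ h₂ h₃ h₄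
    apply minors_eq_of_cubic_relations hcd hz
    · linear_combination h₁
    · linear_combination h₂
    · linear_combination h₃
    · linear_combination h₄
  obtain ⟨t, ht, htcd⟩ : ∃ t : ℂ, (∀ j : Fin N, (j : ℕ) < s → j ≠ c → j ≠ d →
      (Y j j + t) * Y c d = Y c j * Y d j) ∧ (Y c c + t) * (Y d d + t) = Y c d ^ 2 := by
    by_cases hex : ∃ j : Fin N, (j : ℕ) < s ∧ j ≠ c ∧ j ≠ d
    · obtain ⟨j, hj, hjc, hjd⟩ := hex
      have key : ∀ i : Fin N, (i : ℕ) < s → i ≠ c → i ≠ d →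
          (Y i i + -minor2C Y j c j d / Y c d) * Y c d = Y c i * Y d i := by
        intro i hi hic hid
        rw [← hF i j c d hi hj hic.symm hjc.symm hid.symm hjd.symm (.inl hne), minor2C,
          ← hY.apply d i]
        field_simp
        ring
      exact ⟨_, key, (cubic _ j hj hjc hjd (key j hj hjc hjd)).1⟩
    · obtain ⟨t, ht⟩ := exists_quadratic_eq_zero (K := ℂ) (a := 1) (b := Y c c + Y d d)
        (c := Y c c * Y d d - Y c d ^ 2) one_ne_zero (IsAlgClosed.exists_eq_mul_self _)
      exact ⟨t, fun j hj hjc hjd => absurd ⟨j, hj, hjc, hjd⟩ hex, by linear_combination ht⟩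
  refine ⟨t, rank_le_one_of_pivot _ c d ?_ fun a b => ?_⟩
  · rwa [add_smul_partialId_apply_of_ne Y _ (.inl hne)]
  rw [add_smul_partialId_apply_of_ne Y _ (.inl hne)]
  by_cases hac : a = c
  · rw [hac, add_smul_partialId_apply_of_ne Y _ (.inl hne), mul_comm]
  by_cases hbd : b = d
  · rw [hbd, add_smul_partialId_apply_of_ne Y _ (.inl hne)]
  by_cases ha : s ≤ (a : ℕ)
  · simp [add_smul_partialId_apply_of_ne Y t (i := a) (.inr ha), h0' a _ ha]
  by_cases hb : s ≤ (b : ℕ)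
  · have hab : a ≠ b := by
      rintro rfl
      exact ha hb
    have hcb : c ≠ b := by
      rintro rfl
      omega
    simp [add_smul_partialId_apply_of_ne Y t (.inl hab),
      add_smul_partialId_apply_of_ne Y t (.inl hcb), h0 _ b hb]
  push Not at ha hb
  by_cases had : a = d
  · subst had
    rw [add_smul_partialId_apply_of_ne Y _ (.inl (Ne.symm hbd)),
      add_smul_partialId_apply_self Y _ ha]
    by_cases hbc : b = c
    · subst hbc
      rw [add_smul_partialId_apply_self Y _ hb, hY.apply b a]
      linear_combination -htcd
    · rw [add_smul_partialId_apply_of_ne Y _ (.inl (Ne.symm hbc))]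
      linear_combination -(cubic t b hb hbc hbd (ht b hb hbc hbd)).2.1
  rw [add_smul_partialId_apply_of_ne Y _ (.inl had)]
  by_cases hbc : b = c
  · subst hbc
    rw [add_smul_partialId_apply_of_ne Y _ (.inl hac), add_smul_partialId_apply_self Y _ hb,
      hY.apply b a, hY.apply d a]
    linear_combination -(cubic t a ha hac had (ht a ha hac had)).2.2
  rw [add_smul_partialId_apply_of_ne Y _ (.inl (Ne.symm hbc))]
  by_cases hab : a = b
  · subst hab
    rw [add_smul_partialId_apply_self Y _ ha, hY.apply d a]
    linear_combination ht a ha hac had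
  · rw [add_smul_partialId_apply_of_ne Y _ (.inl hab)]
    have h := hE a c b d hac hbd (by
      rintro x (rfl | rfl) (rfl | rfl) <;> contradiction)
    rw [minor2C] at h
    linear_combination h

end Completion

/-- If among any three values of `x` on `P` two coincide, and no two disjoint pairs of points
of `P` both have distinct values, then all values but at most one coincide. -/
theorem exists_eq_off_point {ι K : Type*} [Field K] (P : ι → Prop) (hP : ∃ i, P i) (x : ι → K)
    (hG : ∀ i j k l, P i → P j → P k → P l →
      i ≠ j → i ≠ k → i ≠ l → j ≠ k → j ≠ l → k ≠ l → (x i - x k) * (x j - x l) = 0)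
    (hH : ∀ i j l, P i → P j → P l → i ≠ j → i ≠ l → j ≠ l →
      (x i - x j) * (x j - x l) * (x l - x i) = 0) :
    ∃ (u : K) (e : ι), P e ∧ ∀ i, P i → i ≠ e → x i = u := by
  by_cases hall : ∀ i j, P i → P j → x i = x j
  · obtain ⟨e, he⟩ := hP
    exact ⟨x e, e, he, fun i hi _ => hall i e hi he⟩
  push Not at hall
  obtain ⟨i, j, hi, hj, hij⟩ := hall
  have hij' : i ≠ j := fun h => hij (congrArg x h)
  by_cases hk : ∀ k, P k → k ≠ i → x k = x j
  · exact ⟨x j, i, hi, hk⟩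
  push Not at hk
  obtain ⟨k, hPk, hki, hkj⟩ := hk
  have hkj' : k ≠ j := fun h => hkj (congrArg x h)
  refine ⟨x i, j, hj, fun l hl hlj => ?_⟩
  have hxk : x k = x i := by
    have h := hH i j k hi hj hPk hij' hki.symm hkj'.symm
    grind
  by_cases hli : l = i
  · rw [hli]
  by_cases hlk : l = k
  · rw [hlk, hxk]
  have h := hG i k j l hi hPk hj hl hki.symm hij' (Ne.symm hli) hkj' (Ne.symm hlk) (Ne.symm hlj)
  rcases mul_eq_zero.1 h with h | h
  · exact absurd (sub_eq_zero.1 h) hij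
  · rw [← hxk, sub_eq_zero.1 h]

/-- A symmetric `N × N` complex matrix `Y` can be completed to a matrix of rank at most
one by adding a scalar multiple of the partial identity `I_s` if and only if the
explicit families of quadratic (E), (F), (G) and cubic (H1), (H2) relations among
its entries hold. -/
theorem rank_one_completion_partial_identity_iff (N s : ℕ) (hs2 : 2 ≤ s) (hsN : s ≤ N)
    (Y : Matrix (Fin N) (Fin N) ℂ) (hY : Yᵀ = Y) :
    (∃ t : ℂ, (Y + t • Matrix.diagonal
        (fun i : Fin N => if (i : ℕ) < s then (1 : ℂ) else 0)).rank ≤ 1)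
      ↔ ((∀ a b c d : Fin N, a ≠ b → c ≠ d →
            (∀ x : Fin N, (x = a ∨ x = b) → (x = c ∨ x = d) → s ≤ (x : ℕ)) →
            minor2C Y a b c d = 0) ∧
         (∀ i j c d : Fin N, (i : ℕ) < s → (j : ℕ) < s →
            c ≠ i → c ≠ j → d ≠ i → d ≠ j → (c ≠ d ∨ s ≤ (c : ℕ)) →
            minor2C Y i c i d = minor2C Y j c j d) ∧
         (∀ i j k l : Fin N, (i : ℕ) < s → (j : ℕ) < s → (k : ℕ) < s → (l : ℕ) < s →
            i ≠ j → i ≠ k → i ≠ l → j ≠ k → j ≠ l → k ≠ l →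
            princMinor Y i j - princMinor Y j k + princMinor Y k l
              - princMinor Y l i = 0) ∧
         (∀ i j l : Fin N, (i : ℕ) < s → (j : ℕ) < s → (l : ℕ) < s →
            i ≠ j → i ≠ l → j ≠ l →
            Y i l * (princMinor Y i j - princMinor Y i l)
              - (Y l l - Y j j) * (Y i j * Y j l - Y i l * Y j j) = 0) ∧
         (∀ i j l : Fin N, (i : ℕ) < s → (j : ℕ) < s → (l : ℕ) < s →
            i ≠ j → i ≠ l → j ≠ l →
            (Y i i - Y j j) * princMinor Y i j + (Y j j - Y l l) * princMinor Y j l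
              + (Y l l - Y i i) * princMinor Y l i = 0)) := by
  have hS : Y.IsSymm := hY
  constructor
  · rintro ⟨t, ht⟩
    obtain ⟨hE, hF, hD, hM⟩ := relations_of_rank_le_one hS ht
    refine ⟨hE, fun i j c d hi hj hci hcj hdi hdj hcd => ?_,
      fun i j k l hi hj hk hl hij hik hil hjk hjl hkl => ?_,
      fun i j l hi hj hl hij hil hjl => ?_, fun i j l hi hj hl hij hil hjl => ?_⟩
    · rw [hF i c d hi hci hdi hcd, hF j c d hj hcj hdj hcd]
    · rw [hD i j hi hj hij, hD j k hj hk hjk, hD k l hk hl hkl, hD l i hl hi hil.symm]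
      ring
    · rw [hD i j hi hj hij, hD i l hi hl hil, hM i j l hj hij hil hjl]
      ring
    · rw [hD i j hi hj hij, hD j l hj hl hjl, hD l i hl hi hil.symm]
      ring
  · rintro ⟨hE, hF, hG, hH1, hH2⟩
    by_cases h0 : ∀ c d : Fin N, s ≤ (c : ℕ) → s ≤ (d : ℕ) → Y c d = 0
    swap
    · push Not at h0
      obtain ⟨c, d, hc, hd, hcd⟩ := h0
      exact exists_rank_le_one_of_pivot_ge (by omega) hE hF hc hd hcd
    have h1 := eq_zero_of_block_eq_zero hs2 hsN hE hF hS h0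
    by_cases h2 : ∀ c d : Fin N, (c : ℕ) < s → (d : ℕ) < s → c ≠ d → Y c d = 0
    swap
    · push Not at h2
      obtain ⟨c, d, hc, hd, hne, hcd⟩ := h2
      exact exists_rank_le_one_of_pivot_lt hE hF hH1 hS h1 hc hd hne hcd
    have hoff : ∀ c d : Fin N, c ≠ d → Y c d = 0 := by
      intro c d hne
      by_cases hd : s ≤ (d : ℕ)
      · exact h1 c d hd
      by_cases hc : s ≤ (c : ℕ)
      · rw [← hS.apply c d, h1 d c hc]
      exact h2 c d (by omega) (by omega) hne
    obtain ⟨u, e, he, hu⟩ := exists_eq_off_point (fun i : Fin N => (i : ℕ) < s)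
      ⟨⟨0, by omega⟩, by simp; omega⟩ (fun i => Y i i)
      (fun i j k l hi hj hk hl hij hik hil hjk hjl hkl => by
        have h := hG i j k l hi hj hk hl hij hik hil hjk hjl hkl
        simp only [princMinor, hoff i j hij, hoff j k hjk, hoff k l hkl, hoff l i hil.symm] at h
        linear_combination h)
      (fun i j l hi hj hl hij hil hjl => by
        have h := hH2 i j l hi hj hl hij hil hjl
        simp only [princMinor, hoff i j hij, hoff j l hjl, hoff l i hil.symm] at h
        linear_combination -h)
    refine ⟨-u, ?_⟩
    have hA : Y + (-u) • partialId N s =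
        vecMulVec (Pi.single e (Y e e - u)) (Pi.single e 1) := by
      ext a b
      rw [vecMulVec_apply]
      by_cases hab : a = b
      · subst hab
        by_cases hae : a = e
        · subst hae
          rw [add_smul_partialId_apply_self Y _ he]
          simp [sub_eq_add_neg]
        · rw [Pi.single_eq_of_ne hae, zero_mul]
          by_cases ha : (a : ℕ) < s
          · rw [add_smul_partialId_apply_self Y _ ha, hu a ha hae, add_neg_cancel]
          · rw [add_smul_partialId_apply_of_ne Y _ (.inr (by omega)), h1 a a (by omega)]
      · rw [add_smul_partialId_apply_of_ne Y _ (.inl hab), hoff a b hab]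
        by_cases hae : a = e
        · rw [Pi.single_eq_of_ne (i := e) (i' := b) (fun h => hab (hae.trans h.symm)), mul_zero]
        · rw [Pi.single_eq_of_ne hae, zero_mul]
    rw [hA]
    exact rank_vecMulVec_le _ _
end
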